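/- Let H be a crown-free linear 3-graph and let e = {a,b,c} be an edge of H with d(a) = d(b) = d(c) = 4. For x ∈ {a,b,c}, let M_x denote the union of the sets f \ {x} over all edges f ≠ e of H containing x. Then |M_a ∩ M_b| ≥ 4. -/

import Mathlib

/-- `E` is (the edge set of) a linear 3-graph: every edge has 3 vertices and
any two distinct edges intersect in at most one vertex. -/
def LinearTripleSystem {V : Type*} [DecidableEq V] (E : Finset (Finset V)) : Prop :=
  (∀ e ∈ E, e.card = 3) ∧ ∀ e ∈ E, ∀ f ∈ E, e ≠ f → (e ∩ f).card ≤ 1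

/-- `E` contains a crown: three pairwise disjoint edges (jewels) together with a
base edge intersecting all three jewels. -/
def HasCrown {V : Type*} [DecidableEq V] (E : Finset (Finset V)) : Prop :=
  ∃ base ∈ E, ∃ j1 ∈ E, ∃ j2 ∈ E, ∃ j3 ∈ E,
    Disjoint j1 j2 ∧ Disjoint j1 j3 ∧ Disjoint j2 j3 ∧
    (base ∩ j1).Nonempty ∧ (base ∩ j2).Nonempty ∧ (base ∩ j3).Nonempty

/-- The degree of a vertex: the number of edges containing it. -/
def degree {V : Type*} [DecidableEq V] (E : Finset (Finset V)) (v : V) : ℕ :=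
  (E.filter (fun e => v ∈ e)).card

/-- `linkMatching E e x` is `M_x`: the union of the sets `f \ {x}` over all
edges `f ≠ e` of `E` containing `x`. -/
def linkMatching {V : Type*} [DecidableEq V] (E : Finset (Finset V))
    (e : Finset V) (x : V) : Finset V :=
  (E.filter (fun f => f ≠ e ∧ x ∈ f)).biUnion (fun f => f \ {x})

/-- A family of triples through `x` which pairwise meet only in `x`. -/
structure IsTripleStar {V : Type*} [DecidableEq V] (F : Finset (Finset V)) (x : V) : Prop where
  mem : ∀ f ∈ F, x ∈ f
  card_eq : ∀ f ∈ F, f.card = 3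
  eq_of_mem : ∀ f ∈ F, ∀ g ∈ F, ∀ p ∈ f, p ∈ g → p ≠ x → f = g

/-- The vertices other than the centre `x` that are covered by the family `F`. -/
def starLink {V : Type*} [DecidableEq V] (F : Finset (Finset V)) (x : V) : Finset V :=
  F.biUnion (fun f => f \ {x})

section Star

variable {V : Type*} [DecidableEq V] {F G : Finset (Finset V)} {x y : V}

theorem mem_starLink {p : V} : p ∈ starLink F x ↔ ∃ f ∈ F, p ∈ f ∧ p ≠ x := by
  simp [starLink]

theorem notMem_starLink_self : x ∉ starLink F x := by
  simp [mem_starLink]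

theorem notMem_starLink_of_forall (h : ∀ f ∈ F, y ∉ f) : y ∉ starLink F x := by
  rw [mem_starLink]
  rintro ⟨f, hf, hy, -⟩
  exact h f hf hy

/-- Members of a star meeting a set `g` that avoids the centre do so in distinct vertices. -/
theorem IsTripleStar.card_le_card_inter (hF : IsTripleStar F x) {S : Finset (Finset V)}
    (hS : S ⊆ F) {g : Finset V} (hx : x ∉ g) (hmeet : ∀ f ∈ S, ¬ Disjoint f g) :
    S.card ≤ (g ∩ starLink F x).card := by
  have hpt : ∀ f ∈ S, ∃ p, p ∈ f ∧ p ∈ g := fun f hf => Finset.not_disjoint_iff.1 (hmeet f hf)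
  have : Nonempty V := ⟨x⟩
  choose! p hpf hpg using hpt
  have hne : ∀ f ∈ S, p f ≠ x := fun f hf h => hx (h ▸ hpg f hf)
  refine Finset.card_le_card_of_injOn p (fun f hf => ?_) (fun f hf f' hf' h => ?_)
  · exact Finset.mem_inter.2 ⟨hpg f hf, mem_starLink.2 ⟨f, hS hf, hpf f hf, hne f hf⟩⟩
  · exact hF.eq_of_mem f (hS hf) f' (hS hf') (p f) (hpf f hf) (h ▸ hpf f' hf') (hne f hf)

theorem IsTripleStar.card_le_disjoint_add (hF : IsTripleStar F x) {g : Finset V} (hx : x ∉ g) :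
    F.card ≤ (F.filter (fun f => Disjoint f g)).card + (g ∩ starLink F x).card := by
  have h := hF.card_le_card_inter (Finset.filter_subset (fun f => ¬ Disjoint f g) F) hx
    (fun f hf => (Finset.mem_filter.1 hf).2)
  have := Finset.card_filter_add_card_filter_not (s := F) (fun f => Disjoint f g)
  omega

theorem IsTripleStar.card_inter_le_two (hG : IsTripleStar G y) {g : Finset V} (hg : g ∈ G)
    {W : Finset V} (hy : y ∉ W) : (g ∩ W).card ≤ 2 := by
  have hsub : g ∩ W ⊆ g.erase y := fun p hp => by
    rw [Finset.mem_inter] at hp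
    exact Finset.mem_erase.2 ⟨fun h => hy (h ▸ hp.2), hp.1⟩
  have := Finset.card_le_card hsub
  rw [Finset.card_erase_of_mem (hG.mem g hg), hG.card_eq g hg] at this
  exact this

/-- Two stars whose members all meet each other do so in distinct vertices. -/
theorem IsTripleStar.card_mul_card_le (hF : IsTripleStar F x) (hG : IsTripleStar G y)
    (hxG : ∀ g ∈ G, x ∉ g) (hyF : ∀ f ∈ F, y ∉ f) {S T : Finset (Finset V)} (hS : S ⊆ F)
    (hT : T ⊆ G) {h : Finset V} (hSh : ∀ f ∈ S, Disjoint f h)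
    (hmeet : ∀ f ∈ S, ∀ g ∈ T, ¬ Disjoint f g) :
    S.card * T.card ≤ ((starLink F x ∩ starLink G y) \ h).card := by
  have hpt : ∀ q : Finset V × Finset V, q ∈ S ×ˢ T → ∃ p, p ∈ q.1 ∧ p ∈ q.2 := fun q hq =>
    Finset.not_disjoint_iff.1 (hmeet _ (Finset.mem_product.1 hq).1 _ (Finset.mem_product.1 hq).2)
  have : Nonempty V := ⟨x⟩
  choose! p hp1 hp2 using hpt
  have hmem : ∀ q ∈ S ×ˢ T, q.1 ∈ F ∧ q.2 ∈ G := fun q hq =>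
    ⟨hS (Finset.mem_product.1 hq).1, hT (Finset.mem_product.1 hq).2⟩
  have hnx : ∀ q ∈ S ×ˢ T, p q ≠ x := fun q hq h => hxG _ (hmem q hq).2 (h ▸ hp2 q hq)
  have hny : ∀ q ∈ S ×ˢ T, p q ≠ y := fun q hq h => hyF _ (hmem q hq).1 (h ▸ hp1 q hq)
  rw [← Finset.card_product]
  refine Finset.card_le_card_of_injOn p (fun q hq => ?_) (fun q hq r hr hqr => ?_)
  · refine Finset.mem_sdiff.2 ⟨Finset.mem_inter.2 ⟨?_, ?_⟩, ?_⟩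
    · exact mem_starLink.2 ⟨_, (hmem q hq).1, hp1 q hq, hnx q hq⟩
    · exact mem_starLink.2 ⟨_, (hmem q hq).2, hp2 q hq, hny q hq⟩
    · exact Finset.disjoint_left.1 (hSh _ (Finset.mem_product.1 hq).1) (hp1 q hq)
  · exact Prod.ext
      (hF.eq_of_mem _ (hmem q hq).1 _ (hmem r hr).1 _ (hp1 q hq) (hqr ▸ hp1 r hr) (hnx q hq))
      (hG.eq_of_mem _ (hmem q hq).2 _ (hmem r hr).2 _ (hp2 q hq) (hqr ▸ hp2 r hr) (hny q hq))

end Star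

section ThreeStars

variable {V : Type*} [DecidableEq V] {A B C : Finset (Finset V)} {a b c : V}

/-- If two members of `A` and a member `g` of `B` are disjoint from `h`, and the two members
meet `g`, then `g` contains every vertex of a small common link that lies outside `h`. -/
theorem IsTripleStar.sdiff_subset_of_two_le (hA : IsTripleStar A a) (haB : ∀ g ∈ B, a ∉ g)
    (hbA : ∀ f ∈ A, b ∉ f) {S : Finset (Finset V)} (hS : S ⊆ A) (hS2 : 2 ≤ S.card)
    {g h : Finset V} (hg : g ∈ B) (hgh : Disjoint g h) (hmeet : ∀ f ∈ S, ¬ Disjoint f g)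
    (hM : ((starLink A a ∩ starLink B b) \ h).card ≤ 2) :
    (starLink A a ∩ starLink B b) \ h ⊆ g := by
  have h2 := hA.card_le_card_inter hS (haB g hg) hmeet
  have hsub : g ∩ starLink A a ⊆ (starLink A a ∩ starLink B b) \ h := fun p hp => by
    obtain ⟨hpg, hpA⟩ := Finset.mem_inter.1 hp
    refine Finset.mem_sdiff.2 ⟨Finset.mem_inter.2 ⟨hpA, mem_starLink.2 ⟨g, hg, hpg, ?_⟩⟩,
      Finset.disjoint_left.1 hgh hpg⟩
    rintro rfl
    exact notMem_starLink_of_forall hbA hpA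
  rw [← Finset.eq_of_subset_of_card_le hsub (by omega)]
  exact Finset.inter_subset_left

theorem four_le_card_starLink_inter (hA : IsTripleStar A a) (hB : IsTripleStar B b)
    (hC : IsTripleStar C c) (hA3 : A.card = 3) (hB3 : B.card = 3) (hC3 : C.card = 3)
    (haB : ∀ g ∈ B, a ∉ g) (haC : ∀ h ∈ C, a ∉ h) (hbA : ∀ f ∈ A, b ∉ f)
    (hbC : ∀ h ∈ C, b ∉ h) (hcA : ∀ f ∈ A, c ∉ f) (hcB : ∀ g ∈ B, c ∉ g)
    (hcrown : ∀ f ∈ A, ∀ g ∈ B, ∀ h ∈ C, Disjoint f h → Disjoint g h → ¬ Disjoint f g) :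
    4 ≤ (starLink A a ∩ starLink B b).card := by
  by_contra! hlt
  set M := starLink A a ∩ starLink B b with hM
  have hcMa : c ∉ starLink A a := notMem_starLink_of_forall hcA
  have hcMb : c ∉ starLink B b := notMem_starLink_of_forall hcB
  have hcM : c ∉ M := fun h => hcMa (Finset.mem_inter.1 h).1
  have haM : a ∉ M := fun h => notMem_starLink_self (Finset.mem_inter.1 h).1
  have hbM : b ∉ M := fun h => notMem_starLink_self (Finset.mem_inter.1 h).2
  -- the members of `A` and of `B` disjoint from a member of `C`
  let N (F : Finset (Finset V)) (h : Finset V) := F.filter (fun f => Disjoint f h)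
  have hNsub : ∀ F h, N F h ⊆ F := fun F h => Finset.filter_subset _ _
  have hNmeet : ∀ h ∈ C, ∀ f ∈ N A h, ∀ g ∈ N B h, ¬ Disjoint f g := fun h hh f hf g hg =>
    hcrown f (hNsub _ _ hf) g (hNsub _ _ hg) h hh (Finset.mem_filter.1 hf).2
      (Finset.mem_filter.1 hg).2
  have hNpos : ∀ h ∈ C, 1 ≤ (N A h).card ∧ 1 ≤ (N B h).card := fun h hh => by
    have h1 : A.card ≤ (N A h).card + _ := hA.card_le_disjoint_add (haC h hh)
    have h2 : B.card ≤ (N B h).card + _ := hB.card_le_disjoint_add (hbC h hh)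
    have h3 := hC.card_inter_le_two hh hcMa
    have h4 := hC.card_inter_le_two hh hcMb
    omega
  have hNle : ∀ h ∈ C, (N A h).card ≤ 2 ∧ (N B h).card ≤ 2 := fun h hh => by
    obtain ⟨hp1, hp2⟩ := hNpos h hh
    obtain ⟨f, hf⟩ := Finset.card_pos.1 hp1
    obtain ⟨g, hg⟩ := Finset.card_pos.1 hp2
    have hfA := hNsub _ _ hf
    have hgB := hNsub _ _ hg
    exact ⟨(hA.card_le_card_inter (hNsub A h) (haB g hgB)
        (fun f' hf' => hNmeet h hh f' hf' g hg)).trans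
        (hB.card_inter_le_two hgB (notMem_starLink_of_forall hbA)),
      (hB.card_le_card_inter (hNsub B h) (hbA f hfA)
        (fun g' hg' hd => hNmeet h hh f hf g' hg' hd.symm)).trans
        (hA.card_inter_le_two hfA (notMem_starLink_of_forall haB))⟩
  have hNsum : ∀ h ∈ C, 4 ≤ (N A h).card + (N B h).card + (h ∩ M).card := fun h hh => by
    have h1 : A.card ≤ (N A h).card + _ := hA.card_le_disjoint_add (haC h hh)
    have h2 : B.card ≤ (N B h).card + _ := hB.card_le_disjoint_add (hbC h hh)
    have h3 := Finset.card_union_add_card_inter (h ∩ starLink A a) (h ∩ starLink B b)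
    rw [← Finset.inter_union_distrib_left, ← Finset.inter_inter_distrib_left, ← hM] at h3
    have h4 := hC.card_inter_le_two hh (W := starLink A a ∪ starLink B b)
      (by simp [hcMa, hcMb])
    omega
  have hNmul : ∀ h ∈ C, (N A h).card * (N B h).card ≤ (M \ h).card := fun h hh =>
    hA.card_mul_card_le hB haB hbA (hNsub A h) (hNsub B h)
      (fun f hf => (Finset.mem_filter.1 hf).2) (hNmeet h hh)
  have hmeetM : ∀ h ∈ C, ∃ p, p ∈ h ∧ p ∈ M := fun h hh => by
    by_contra! hno
    have h0 : (h ∩ M).card = 0 := by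
      rw [Finset.card_eq_zero, ← Finset.disjoint_iff_inter_eq_empty]
      exact Finset.disjoint_left.2 hno
    have h1 := hNle h hh
    have h2 := hNsum h hh
    have h3 := hNmul h hh
    have h4 : (M \ h).card ≤ M.card := Finset.card_le_card Finset.sdiff_subset
    have h5 : (N A h).card = 2 := by omega
    have h6 : (N B h).card = 2 := by omega
    rw [h5, h6] at h3
    omega
  have : Nonempty V := ⟨c⟩
  choose! t hth htM using hmeetM
  have hinj : Set.InjOn t C := fun h hh h' hh' heq =>
    hC.eq_of_mem h hh h' hh' (t h) (hth h hh) (heq ▸ hth h' hh') (fun hc => hcM (hc ▸ htM h hh))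
  have himg : C.image t = M := by
    refine Finset.eq_of_subset_of_card_le (fun p hp => ?_) ?_
    · obtain ⟨h, hh, rfl⟩ := Finset.mem_image.1 hp
      exact htM h hh
    · rw [Finset.card_image_of_injOn hinj]
      omega
  have hM3 : M.card = 3 := by rw [← himg, Finset.card_image_of_injOn hinj, hC3]
  have hinter : ∀ h ∈ C, h ∩ M = {t h} := fun h hh => by
    ext p
    rw [Finset.mem_inter, Finset.mem_singleton]
    refine ⟨fun ⟨hph, hpM⟩ => ?_, fun hp => hp ▸ ⟨hth h hh, htM h hh⟩⟩
    obtain ⟨h', hh', rfl⟩ := Finset.mem_image.1 (himg ▸ hpM)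
    rw [hC.eq_of_mem h hh h' hh' _ hph (hth h' hh') (fun hc => hcM (hc ▸ hpM))]
  have hcover : ∀ x ∈ M, ∃ X, (X ∈ A ∨ X ∈ B) ∧ x ∉ X ∧ ∀ z ∈ M, z ≠ x → z ∈ X := fun x hx => by
    obtain ⟨h, hh, rfl⟩ := Finset.mem_image.1 (himg ▸ hx)
    have hint : M ∩ h = {t h} := Finset.inter_comm M h ▸ hinter h hh
    have hsd : (M \ h).card = 2 := by
      have := Finset.card_sdiff_add_card_inter M h
      rw [hint, Finset.card_singleton] at this
      omega
    have hout : ∀ z ∈ M, z ≠ t h → z ∈ M \ h := fun z hz hzt =>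
      Finset.mem_sdiff.2 ⟨hz, fun hzh => hzt (Finset.mem_singleton.1
        (hint ▸ Finset.mem_inter.2 ⟨hz, hzh⟩))⟩
    obtain ⟨hp1, hp2⟩ := hNpos h hh
    obtain ⟨f, hf⟩ := Finset.card_pos.1 hp1
    obtain ⟨g, hg⟩ := Finset.card_pos.1 hp2
    have hfh : Disjoint f h := (Finset.mem_filter.1 hf).2
    have hgh : Disjoint g h := (Finset.mem_filter.1 hg).2
    have hsum := hNsum h hh
    rw [hinter h hh, Finset.card_singleton] at hsum
    rcases (by omega : 2 ≤ (N A h).card ∨ 2 ≤ (N B h).card) with h2 | h2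
    · have hsub := hA.sdiff_subset_of_two_le (b := b) haB hbA (hNsub A h) h2 (hNsub _ _ hg) hgh
        (fun f' hf' => hNmeet h hh f' hf' g hg) hsd.le
      exact ⟨g, Or.inr (hNsub _ _ hg), fun hx' => Finset.disjoint_left.1 hgh hx' (hth h hh),
        fun z hz hzt => hsub (hout z hz hzt)⟩
    · have hsub := hB.sdiff_subset_of_two_le (b := a) hbA haB (hNsub B h) h2 (hNsub _ _ hf) hfh
        (fun g' hg' hd => hNmeet h hh f hf g' hg' hd.symm)
        (by rw [Finset.inter_comm, ← hM]; exact hsd.le)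
      rw [Finset.inter_comm, ← hM] at hsub
      exact ⟨f, Or.inl (hNsub _ _ hf), fun hx' => Finset.disjoint_left.1 hfh hx' (hth h hh),
        fun z hz hzt => hsub (hout z hz hzt)⟩
  have hclash : ∀ {F : Finset (Finset V)} {v : V}, IsTripleStar F v → v ∉ M →
      ∀ x ∈ M, ∀ y ∈ M, ∀ z ∈ M, x ≠ y → z ≠ x → z ≠ y → ∀ X ∈ F, ∀ Y ∈ F,
      (∀ w ∈ M, w ≠ x → w ∈ X) → y ∉ Y → (∀ w ∈ M, w ≠ y → w ∈ Y) → False :=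
    fun hF hv x _ y hy z hz hxy hzx hzy X hX Y hY hXw hyY hYw => by
      have hXY := hF.eq_of_mem X hX Y hY z (hXw z hz hzx) (hYw z hz hzy) (fun h => hv (h ▸ hz))
      exact hyY (hXY ▸ hXw y hy hxy.symm)
  obtain ⟨x, y, z, hxy, hxz, hyz, hMxyz⟩ := Finset.card_eq_three.1 hM3
  have hx : x ∈ M := by simp [hMxyz]
  have hy : y ∈ M := by simp [hMxyz]
  have hz : z ∈ M := by simp [hMxyz]
  obtain ⟨X, hX, hxX, hXw⟩ := hcover x hx
  obtain ⟨Y, hY, hyY, hYw⟩ := hcover y hy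
  obtain ⟨Z, hZ, hzZ, hZw⟩ := hcover z hz
  have pXY : ∀ {F : Finset (Finset V)} {v : V}, IsTripleStar F v → v ∉ M → X ∈ F → Y ∈ F → False :=
    fun hF hv h1 h2 => hclash hF hv x hx y hy z hz hxy hxz.symm hyz.symm X h1 Y h2 hXw hyY hYw
  have pXZ : ∀ {F : Finset (Finset V)} {v : V}, IsTripleStar F v → v ∉ M → X ∈ F → Z ∈ F → False :=
    fun hF hv h1 h2 => hclash hF hv x hx z hz y hy hxz hxy.symm hyz X h1 Z h2 hXw hzZ hZw
  have pYZ : ∀ {F : Finset (Finset V)} {v : V}, IsTripleStar F v → v ∉ M → Y ∈ F → Z ∈ F → False :=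
    fun hF hv h1 h2 => hclash hF hv y hy z hz x hx hyz hxy hxz Y h1 Z h2 hYw hzZ hZw
  rcases hX with hX | hX <;> rcases hY with hY | hY
  · exact pXY hA haM hX hY
  · rcases hZ with hZ | hZ
    · exact pXZ hA haM hX hZ
    · exact pYZ hB hbM hY hZ
  · rcases hZ with hZ | hZ
    · exact pYZ hA haM hY hZ
    · exact pXZ hB hbM hX hZ
  · exact pXY hB hbM hX hY

end ThreeStars

section Link

variable {V : Type*} [DecidableEq V] {E : Finset (Finset V)}

theorem LinearTripleSystem.eq_of_mem (hlin : LinearTripleSystem E) {f g : Finset V} (hf : f ∈ E)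
    (hg : g ∈ E) {p q : V} (hpq : p ≠ q) (hpf : p ∈ f) (hpg : p ∈ g) (hqf : q ∈ f) (hqg : q ∈ g) :
    f = g := by
  by_contra hne
  exact hpq (Finset.card_le_one.1 (hlin.2 f hf g hg hne) p (Finset.mem_inter.2 ⟨hpf, hpg⟩) q
    (Finset.mem_inter.2 ⟨hqf, hqg⟩))

theorem LinearTripleSystem.isTripleStar_filter (hlin : LinearTripleSystem E) (e : Finset V)
    (x : V) : IsTripleStar (E.filter (fun f => f ≠ e ∧ x ∈ f)) x where
  mem _ hf := (Finset.mem_filter.1 hf).2.2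
  card_eq f hf := hlin.1 f (Finset.mem_filter.1 hf).1
  eq_of_mem _ hf _ hg _ hpf hpg hpx :=
    hlin.eq_of_mem (Finset.mem_filter.1 hf).1 (Finset.mem_filter.1 hg).1 hpx hpf hpg
      (Finset.mem_filter.1 hf).2.2 (Finset.mem_filter.1 hg).2.2

theorem card_filter_ne_add_one {e : Finset V} {x : V} (he : e ∈ E) (hx : x ∈ e) :
    (E.filter (fun f => f ≠ e ∧ x ∈ f)).card + 1 = degree E x := by
  have : E.filter (fun f => f ≠ e ∧ x ∈ f) = (E.filter (fun f => x ∈ f)).erase e := by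
    ext f
    simp only [Finset.mem_filter, Finset.mem_erase]
    tauto
  rw [this, degree]
  exact Finset.card_erase_add_one (Finset.mem_filter.2 ⟨he, hx⟩)

theorem LinearTripleSystem.notMem_of_mem_filter (hlin : LinearTripleSystem E) {e : Finset V}
    (he : e ∈ E) {x y : V} (hxy : x ≠ y) (hx : x ∈ e) (hy : y ∈ e) :
    ∀ f ∈ E.filter (fun f => f ≠ e ∧ x ∈ f), y ∉ f := fun f hf hyf => by
  obtain ⟨hfE, hfe, hxf⟩ := Finset.mem_filter.1 hf
  exact hfe (hlin.eq_of_mem hfE he hxy hxf hx hyf hy)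

end Link

/-- In a crown-free linear 3-graph with an edge `e = {a,b,c}` all of whose
vertices have degree 4, we have `|M_a ∩ M_b| ≥ 4`. -/
theorem linkMatchings_inter_ge_four {V : Type*} [DecidableEq V] (E : Finset (Finset V))
    (hlin : LinearTripleSystem E) (hcf : ¬ HasCrown E)
    (a b c : V) (hab : a ≠ b) (hac : a ≠ c) (hbc : b ≠ c)
    (he : ({a, b, c} : Finset V) ∈ E)
    (hda : degree E a = 4) (hdb : degree E b = 4) (hdc : degree E c = 4) :
    4 ≤ ((linkMatching E {a, b, c} a) ∩ (linkMatching E {a, b, c} b)).card := by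
  have hae : a ∈ ({a, b, c} : Finset V) := by simp
  have hbe : b ∈ ({a, b, c} : Finset V) := by simp
  have hce : c ∈ ({a, b, c} : Finset V) := by simp
  have hA3 := card_filter_ne_add_one he hae
  have hB3 := card_filter_ne_add_one he hbe
  have hC3 := card_filter_ne_add_one he hce
  refine four_le_card_starLink_inter (hlin.isTripleStar_filter _ a) (hlin.isTripleStar_filter _ b)
    (hlin.isTripleStar_filter {a, b, c} c) (by omega) (by omega) (by omega)
    (hlin.notMem_of_mem_filter he hab.symm hbe hae) (hlin.notMem_of_mem_filter he hac.symm hce hae)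
    (hlin.notMem_of_mem_filter he hab hae hbe) (hlin.notMem_of_mem_filter he hbc.symm hce hbe)
    (hlin.notMem_of_mem_filter he hac hae hce) (hlin.notMem_of_mem_filter he hbc hbe hce) ?_
  intro f hf g hg h hh hfh hgh hfg
  obtain ⟨hfE, -, haf⟩ := Finset.mem_filter.1 hf
  obtain ⟨hgE, -, hbg⟩ := Finset.mem_filter.1 hg
  obtain ⟨hhE, -, hch⟩ := Finset.mem_filter.1 hh
  exact hcf ⟨_, he, f, hfE, g, hgE, h, hhE, hfg, hfh, hgh, ⟨a, Finset.mem_inter.2 ⟨hae, haf⟩⟩,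
    ⟨b, Finset.mem_inter.2 ⟨hbe, hbg⟩⟩, ⟨c, Finset.mem_inter.2 ⟨hce, hch⟩⟩⟩
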